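/- The numbers 2 and 1094 satisfy ‖2·1094‖ = ‖2188‖ = ‖3^7 + 1‖ ≤ 22 < 24 = ‖2‖ + ‖1094‖, exhibiting a strict failure of additivity of integer complexity under multiplication; in particular ‖3^7 + 1‖ ≤ 22. -/

import Mathlib

/-- `ExprCost n c` : there is an arithmetic expression for `n` built from the
constant `1`, addition and multiplication (and parentheses) using exactly `c` ones. -/
inductive ExprCost : ℕ → ℕ → Prop
  | one : ExprCost 1 1
  | add {a b c d : ℕ} : ExprCost a c → ExprCost b d → ExprCost (a + b) (c + d)
  | mul {a b c d : ℕ} : ExprCost a c → ExprCost b d → ExprCost (a * b) (c + d)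

/-- The integer complexity `‖n‖`: the least number of `1`'s needed to write `n`. -/
noncomputable def cpx (n : ℕ) : ℕ := sInf {c | ExprCost n c}

namespace ExprCost

theorem pos {n c : ℕ} (h : ExprCost n c) : 1 ≤ n := by
  induction h with
  | one => exact le_rfl
  | add _ _ iha _ => omega
  | mul _ _ iha ihb => exact Nat.mul_pos iha ihb

theorem cost_pos {n c : ℕ} (h : ExprCost n c) : 1 ≤ c := by
  induction h <;> omega

theorem succ_cube_le {n c : ℕ} (hn : 1 ≤ n) (hc : 1 ≤ c) (h : n ^ 3 ≤ 3 ^ c) :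
    (n + 1) ^ 3 ≤ 3 ^ (c + 1) := by
  rcases (by omega : n = 1 ∨ n = 2 ∨ 3 ≤ n) with rfl | rfl | hn3
  · calc (1 + 1) ^ 3 ≤ 3 ^ (1 + 1) := by norm_num
      _ ≤ 3 ^ (c + 1) := Nat.pow_le_pow_right (by norm_num) (by omega)
  · have hc2 : 2 ≤ c := by
      by_contra! hlt
      obtain rfl : c = 1 := by omega
      norm_num at h
    calc (2 + 1) ^ 3 ≤ 3 ^ (2 + 1) := by norm_num
      _ ≤ 3 ^ (c + 1) := Nat.pow_le_pow_right (by norm_num) (by omega)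
  · obtain ⟨k, rfl⟩ := Nat.exists_eq_add_of_le hn3
    rw [pow_succ 3 c]
    have : (3 + k + 1) ^ 3 ≤ (3 + k) ^ 3 * 3 := by ring_nf; nlinarith [Nat.zero_le k]
    omega

/-- An expression for `n` with `c` ones satisfies `n ≤ 3 ^ (c / 3)`. -/
theorem cube_le {n c : ℕ} (h : ExprCost n c) : n ^ 3 ≤ 3 ^ c := by
  induction h with
  | one => norm_num
  | @add a b c d ha hb iha ihb =>
    rcases (by have := ha.pos; have := hb.pos; omega : a = 1 ∨ b = 1 ∨ 2 ≤ a ∧ 2 ≤ b) with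
      rfl | rfl | ⟨ha2, hb2⟩
    · rw [add_comm 1 b]
      exact (succ_cube_le hb.pos hb.cost_pos ihb).trans
        (Nat.pow_le_pow_right (by norm_num) (by have := ha.cost_pos; omega))
    · exact (succ_cube_le ha.pos ha.cost_pos iha).trans
        (Nat.pow_le_pow_right (by norm_num) (by have := hb.cost_pos; omega))
    · calc (a + b) ^ 3 ≤ (a * b) ^ 3 := Nat.pow_le_pow_left (by nlinarith) 3
        _ = a ^ 3 * b ^ 3 := mul_pow a b 3
        _ ≤ 3 ^ c * 3 ^ d := Nat.mul_le_mul iha ihb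
        _ = 3 ^ (c + d) := (pow_add 3 c d).symm
  | @mul a b c d _ _ iha ihb =>
    rw [mul_pow, pow_add]
    exact Nat.mul_le_mul iha ihb

theorem two_le_cost {n c : ℕ} (h : ExprCost n c) (hn : 2 ≤ n) : 2 ≤ c := by
  by_contra! hlt
  have hc := h.cube_le
  obtain rfl : c = 1 := by have := h.cost_pos; omega
  have : 2 ^ 3 ≤ n ^ 3 := Nat.pow_le_pow_left hn 3
  omega

/-- A sum of two terms that are both at least `2` stays well below the maximum `3 ^ (c / 3)`. -/
theorem nine_mul_cube_add_sub_two_le {a b c d : ℕ} (ha : ExprCost a c) (hb : ExprCost b d)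
    (ha2 : 2 ≤ a) (hb2 : 2 ≤ b) : 9 * (a + b - 2) ^ 3 ≤ 3 ^ (c + d) := by
  have hc : 3 ^ 2 ≤ 3 ^ c := Nat.pow_le_pow_right (by norm_num) (ha.two_le_cost ha2)
  have hd : 3 ^ 2 ≤ 3 ^ d := Nat.pow_le_pow_right (by norm_num) (hb.two_le_cost hb2)
  rw [pow_add]
  rcases (by omega : a = 2 ∨ b = 2 ∨ 3 ≤ a ∧ 3 ≤ b) with rfl | rfl | ⟨ha3, hb3⟩
  · rw [Nat.add_sub_cancel_left]
    exact Nat.mul_le_mul hc hb.cube_le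
  · rw [Nat.add_sub_cancel, mul_comm]
    exact Nat.mul_le_mul ha.cube_le hd
  · refine le_trans ?_ (Nat.mul_le_mul ha.cube_le hb.cube_le)
    obtain ⟨x, rfl⟩ := Nat.exists_eq_add_of_le ha3
    obtain ⟨y, rfl⟩ := Nat.exists_eq_add_of_le hb3
    have h : 9 * (3 + x + (3 + y) - 2) ≤ 4 * ((3 + x) * (3 + y)) := by
      have : 3 + x + (3 + y) - 2 = 4 + x + y := by omega
      rw [this]
      nlinarith [Nat.zero_le (x * y)]
    have h3 := Nat.pow_le_pow_left h 3
    rw [mul_pow, mul_pow 4, mul_pow (3 + x)] at h3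
    omega

/-- The outermost operation of an expression, after removing factors equal to `1`. -/
theorem split {n c : ℕ} (h : ExprCost n c) : n = 1 ∨ (∃ d < c, ExprCost (n - 1) d) ∨
    9 * (n - 2) ^ 3 ≤ 3 ^ c ∨
    ∃ a b i j, 2 ≤ a ∧ a ≤ b ∧ a * b = n ∧ i + j ≤ c ∧ ExprCost a i ∧ ExprCost b j := by
  induction h with
  | one => exact .inl rfl
  | @add a b c d ha hb _ _ =>
    have hc := ha.cost_pos
    have hd := hb.cost_pos
    rcases (by have := ha.pos; have := hb.pos; omega : a = 1 ∨ b = 1 ∨ 2 ≤ a ∧ 2 ≤ b) with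
      rfl | rfl | ⟨ha2, hb2⟩
    · exact .inr (.inl ⟨d, by omega, by rwa [Nat.add_sub_cancel_left]⟩)
    · exact .inr (.inl ⟨c, by omega, by rwa [Nat.add_sub_cancel]⟩)
    · exact .inr (.inr (.inl (nine_mul_cube_add_sub_two_le ha hb ha2 hb2)))
  | @mul a b c d ha hb iha ihb =>
    rcases (by have := ha.pos; have := hb.pos; omega : a = 1 ∨ b = 1 ∨ 2 ≤ a ∧ 2 ≤ b) with
      rfl | rfl | ⟨ha2, hb2⟩
    · rw [one_mul]
      refine ihb.imp_right (Or.imp ?_ (Or.imp ?_ ?_))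
      · rintro ⟨e, he, h⟩
        exact ⟨e, by omega, h⟩
      · exact fun h ↦ h.trans (Nat.pow_le_pow_right (by norm_num) (by omega))
      · rintro ⟨x, y, i, j, hx, hxy, hn, hij, h⟩
        exact ⟨x, y, i, j, hx, hxy, hn, by omega, h⟩
    · rw [mul_one]
      refine iha.imp_right (Or.imp ?_ (Or.imp ?_ ?_))
      · rintro ⟨e, he, h⟩
        exact ⟨e, by omega, h⟩
      · exact fun h ↦ h.trans (Nat.pow_le_pow_right (by norm_num) (by omega))
      · rintro ⟨x, y, i, j, hx, hxy, hn, hij, h⟩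
        exact ⟨x, y, i, j, hx, hxy, hn, by omega, h⟩
    · rcases le_total a b with hab | hab
      · exact .inr (.inr (.inr ⟨a, b, c, d, ha2, hab, rfl, le_rfl, ha, hb⟩))
      · exact .inr (.inr (.inr ⟨b, a, d, c, hb2, hab, mul_comm b a, by omega, hb, ha⟩))

end ExprCost

/-- Every expression for `n` uses at least `m` ones. -/
def CostAtLeast (n m : ℕ) : Prop := ∀ c, ExprCost n c → m ≤ c

namespace CostAtLeast

theorem of_lt_cube {n m : ℕ} (h : 3 ^ m < n ^ 3) : CostAtLeast n (m + 1) := fun _ hc ↦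
  (Nat.pow_lt_pow_iff_right (by norm_num : 1 < 3)).1 (h.trans_le hc.cube_le)

theorem of_split {n m : ℕ} (hn : n ≠ 1) (hsub : CostAtLeast (n - 1) m)
    (hadd : 3 ^ m < 9 * (n - 2) ^ 3)
    (hmul : ∀ a b, 2 ≤ a → a ≤ b → a * b = n →
      ∃ k l, m + 1 ≤ k + l ∧ CostAtLeast a k ∧ CostAtLeast b l) :
    CostAtLeast n (m + 1) := by
  intro c hc
  rcases hc.split with h | ⟨d, hd, h⟩ | h | ⟨a, b, i, j, ha, hab, habn, hij, hai, hbj⟩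
  · exact absurd h hn
  · have := hsub d h
    omega
  · exact (Nat.pow_lt_pow_iff_right (by norm_num : 1 < 3)).1 (hadd.trans_le h)
  · obtain ⟨k, l, hkl, hk, hl⟩ := hmul a b ha hab habn
    have := hk i hai
    have := hl j hbj
    omega

theorem two : CostAtLeast 2 2 := of_lt_cube (by norm_num)

theorem three : CostAtLeast 3 3 := of_lt_cube (by norm_num)

theorem six : CostAtLeast 6 5 := of_lt_cube (by norm_num)

theorem seven : CostAtLeast 7 6 := of_lt_cube (by norm_num)

theorem thirteen : CostAtLeast 13 8 := of_lt_cube (by norm_num)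

theorem fourteen : CostAtLeast 14 8 := of_lt_cube (by norm_num)

theorem twenty_one : CostAtLeast 21 9 := of_lt_cube (by norm_num)

theorem thirty_nine : CostAtLeast 39 11 := of_lt_cube (by norm_num)

theorem forty_two : CostAtLeast 42 11 := of_lt_cube (by norm_num)

theorem twenty_six : CostAtLeast 26 10 := by
  refine of_split (by norm_num) (of_lt_cube (by norm_num)) (by norm_num) fun a b ha hab h ↦ ?_
  have : a ≤ 5 := by nlinarith
  interval_cases a <;> try omega
  obtain rfl : b = 13 := by omega
  exact ⟨2, 8, by norm_num, two, thirteen⟩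

theorem seventy_eight : CostAtLeast 78 13 := by
  refine of_split (by norm_num) (of_lt_cube (by norm_num)) (by norm_num) fun a b ha hab h ↦ ?_
  have : a ≤ 8 := by nlinarith
  interval_cases a <;> try omega
  · obtain rfl : b = 39 := by omega
    exact ⟨2, 11, by norm_num, two, thirty_nine⟩
  · obtain rfl : b = 26 := by omega
    exact ⟨3, 10, by norm_num, three, twenty_six⟩
  · obtain rfl : b = 13 := by omega
    exact ⟨5, 8, by norm_num, six, thirteen⟩

theorem ninety_one : CostAtLeast 91 14 := by
  refine of_split (by norm_num) (of_lt_cube (by norm_num)) (by norm_num) fun a b ha hab h ↦ ?_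
  have : a ≤ 9 := by nlinarith
  interval_cases a <;> try omega
  obtain rfl : b = 13 := by omega
  exact ⟨6, 8, by norm_num, seven, thirteen⟩

theorem one_hundred_eighty_two : CostAtLeast 182 16 := by
  refine of_split (by norm_num) (of_lt_cube (by norm_num)) (by norm_num) fun a b ha hab h ↦ ?_
  have : a ≤ 13 := by nlinarith
  interval_cases a <;> try omega
  · obtain rfl : b = 91 := by omega
    exact ⟨2, 14, by norm_num, two, ninety_one⟩
  · obtain rfl : b = 26 := by omega
    exact ⟨6, 10, by norm_num, seven, twenty_six⟩
  · obtain rfl : b = 14 := by omega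
    exact ⟨8, 8, by norm_num, thirteen, fourteen⟩

theorem two_hundred_seventy_three : CostAtLeast 273 17 := by
  refine of_split (by norm_num) (of_lt_cube (by norm_num)) (by norm_num) fun a b ha hab h ↦ ?_
  have : a ≤ 16 := by nlinarith
  interval_cases a <;> try omega
  · obtain rfl : b = 91 := by omega
    exact ⟨3, 14, by norm_num, three, ninety_one⟩
  · obtain rfl : b = 39 := by omega
    exact ⟨6, 11, by norm_num, seven, thirty_nine⟩
  · obtain rfl : b = 21 := by omega
    exact ⟨8, 9, by norm_num, thirteen, twenty_one⟩

theorem five_hundred_forty_six : CostAtLeast 546 19 := by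
  refine of_split (by norm_num) (of_lt_cube (by norm_num)) (by norm_num) fun a b ha hab h ↦ ?_
  have : a ≤ 23 := by nlinarith
  interval_cases a <;> try omega
  · obtain rfl : b = 273 := by omega
    exact ⟨2, 17, by norm_num, two, two_hundred_seventy_three⟩
  · obtain rfl : b = 182 := by omega
    exact ⟨3, 16, by norm_num, three, one_hundred_eighty_two⟩
  · obtain rfl : b = 91 := by omega
    exact ⟨5, 14, by norm_num, six, ninety_one⟩
  · obtain rfl : b = 78 := by omega
    exact ⟨6, 13, by norm_num, seven, seventy_eight⟩
  · obtain rfl : b = 42 := by omega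
    exact ⟨8, 11, by norm_num, thirteen, forty_two⟩
  · obtain rfl : b = 39 := by omega
    exact ⟨8, 11, by norm_num, fourteen, thirty_nine⟩
  · obtain rfl : b = 26 := by omega
    exact ⟨9, 10, by norm_num, twenty_one, twenty_six⟩

theorem five_hundred_forty_seven : CostAtLeast 547 20 := by
  refine of_split (by norm_num) five_hundred_forty_six (by norm_num) fun a b ha hab h ↦ ?_
  have : a ≤ 23 := by nlinarith
  interval_cases a <;> omega

theorem one_thousand_ninety_three : CostAtLeast 1093 21 := by
  refine of_split (by norm_num) (of_lt_cube (by norm_num)) (by norm_num) fun a b ha hab h ↦ ?_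
  have : a ≤ 33 := by nlinarith
  interval_cases a <;> omega

theorem one_thousand_ninety_four : CostAtLeast 1094 22 := by
  refine of_split (by norm_num) one_thousand_ninety_three (by norm_num) fun a b ha hab h ↦ ?_
  have : a ≤ 33 := by nlinarith
  interval_cases a <;> try omega
  obtain rfl : b = 547 := by omega
  exact ⟨2, 20, by norm_num, two, five_hundred_forty_seven⟩

theorem cpx_eq {n m : ℕ} (hm : CostAtLeast n m) (h : ExprCost n m) : cpx n = m :=
  IsLeast.csInf_eq ⟨h, hm⟩

end CostAtLeast

theorem exprCost_two : ExprCost 2 2 := .add .one .one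

theorem exprCost_three : ExprCost 3 3 := .add exprCost_two .one

theorem exprCost_three_pow (k : ℕ) : ExprCost (3 ^ (k + 1)) (3 * (k + 1)) := by
  induction k with
  | zero => exact exprCost_three
  | succ k ih => exact .mul ih exprCost_three

theorem exprCost_1094 : ExprCost 1094 22 := by
  have h6 : ExprCost 6 5 := .mul exprCost_two exprCost_three
  have h7 : ExprCost 7 6 := .add h6 .one
  have h13 : ExprCost 13 8 := .add (.mul h6 exprCost_two) .one
  have h546 : ExprCost 546 19 := .mul h6 (.mul h7 h13)
  exact .mul (.add h546 .one) exprCost_two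

theorem cpx_2188_counterexample :
    2 * 1094 = 3 ^ 7 + 1 ∧ cpx (2 * 1094) = cpx (3 ^ 7 + 1) ∧
    cpx (3 ^ 7 + 1) ≤ 22 ∧ cpx 2 + cpx 1094 = 24 ∧ (22 : ℕ) < 24 := by
  refine ⟨by norm_num, by norm_num, Nat.sInf_le (ExprCost.add (exprCost_three_pow 6) .one), ?_, by norm_num⟩
  rw [CostAtLeast.two.cpx_eq exprCost_two,
    CostAtLeast.one_thousand_ninety_four.cpx_eq exprCost_1094]
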